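/- Let n ≥ 1, m ≥ 1, 0 < κ < 1, 1 ≤ p_1,…,p_m < ∞ with min{p_1,…,p_m} = 1, and 1/p = 1/p_1 + ⋯ + 1/p_m. Then there exists a constant C > 0 such that for all measurable f_1,…,f_m on ℝⁿ with ‖f_i‖_{L^{p_i,κ}} < ∞, ‖M(f⃗)‖_{WL^{p,κ}} ≤ C ∏_{i=1}^m ‖f_i‖_{L^{p_i,κ}}. -/

import Mathlib

open MeasureTheory Metric ENNReal

noncomputable section

/-- Euclidean space `ℝⁿ`. -/
abbrev Euc (n : ℕ) := EuclideanSpace ℝ (Fin n)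

/-- `Ω` is homogeneous of degree zero. -/
def HomogZero {n : ℕ} (Ω : Euc n → ℝ) : Prop :=
  ∀ ⦃l : ℝ⦄, 0 < l → ∀ x, Ω (l • x) = Ω x

/-- The `L^s` norm of `Ω` on the unit sphere `S^{n-1}`, where the surface measure
`volume.toSphere` is normalized so that the polar coordinate formula
`∫_{ℝⁿ} g(y) dy = ∫_0^∞ ∫_{S^{n-1}} g(ρθ) ρ^{n-1} dσ(θ) dρ` holds. -/
noncomputable def sphereLpNorm (n : ℕ) (s : ℝ≥0∞) (Ω : Euc n → ℝ) : ℝ≥0∞ :=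
  eLpNorm (fun θ : sphere (0 : Euc n) 1 => Ω θ.1) s ((volume : Measure (Euc n)).toSphere)

/-- `Ω ∈ L^s(S^{n-1})`: measurable, homogeneous of degree zero, finite sphere `L^s` norm. -/
def MemSphereLp (n : ℕ) (s : ℝ≥0∞) (Ω : Euc n → ℝ) : Prop :=
  Measurable Ω ∧ HomogZero Ω ∧ sphereLpNorm n s Ω < ⊤

/-- The conjugate exponent `s' = s/(s-1)` (with `s' = 1` for `s = ∞`). -/
noncomputable def conjExp (s : ℝ≥0∞) : ℝ := if s = ⊤ then 1 else s.toReal / (s.toReal - 1)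

/-- The multilinear fractional integral operator with homogeneous kernels,
`T_{Ω,α;m}(f⃗)(x) = ∫_{(ℝⁿ)^m} ∏ᵢ Ωᵢ(x-yᵢ) fᵢ(yᵢ) / ‖(x-y₁,…,x-y_m)‖^{mn-α} dy⃗`. -/
noncomputable def multiT {n : ℕ} (m : ℕ) (α : ℝ) (Ω f : Fin m → Euc n → ℝ) (x : Euc n) : ℝ :=
  ∫ y : Fin m → Euc n,
    (∏ i, Ω i (x - y i) * f i (y i)) /
      (Real.sqrt (∑ j, ‖x - y j‖ ^ 2)) ^ ((m * n : ℝ) - α)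

/-- The multilinear maximal operator `𝓜(f⃗)(x)`, with values in `[0,∞]`. -/
noncomputable def multiM {n : ℕ} (m : ℕ) (f : Fin m → Euc n → ℝ) (x : Euc n) : ℝ≥0∞ :=
  ⨆ r : Set.Ioi (0 : ℝ),
    ∏ i, (volume (ball x (r : ℝ)))⁻¹ * ∫⁻ y in ball x (r : ℝ), ENNReal.ofReal |f i y|

/-- `𝓜_t(f⃗)(x) = 𝓜(|f₁|^t,…,|f_m|^t)(x)^{1/t}`, with values in `[0,∞]`. -/
noncomputable def multiMt {n : ℕ} (m : ℕ) (t : ℝ) (f : Fin m → Euc n → ℝ) (x : Euc n) : ℝ≥0∞ :=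
  (multiM m (fun i y => |f i y| ^ t) x) ^ (1 / t)

/-- The multilinear fractional maximal operator with homogeneous kernels,
`M_{Ω,α;m}(f⃗)(x) = sup_{r>0} ∏ᵢ m(B(x,r))^{α/(mn)-1} ∫_{|x-yᵢ|<r} |Ωᵢ(x-yᵢ) fᵢ(yᵢ)| dyᵢ`,
with values in `[0,∞]`. -/
noncomputable def multiMF {n : ℕ} (m : ℕ) (α : ℝ) (Ω f : Fin m → Euc n → ℝ) (x : Euc n) :
    ℝ≥0∞ :=
  ⨆ r : Set.Ioi (0 : ℝ),
    ∏ i, (volume (ball x (r : ℝ))) ^ (α / (m * n : ℝ) - 1) *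
      ∫⁻ y in ball x (r : ℝ), ENNReal.ofReal |Ω i (x - y) * f i y|

/-- Morrey norm of a `[0,∞]`-valued function:
`sup_B (m(B)^{-κ} ∫_B F^p)^{1/p}`, the supremum over all balls `B ⊆ ℝⁿ`. -/
noncomputable def morreyNormE {n : ℕ} (p κ : ℝ) (F : Euc n → ℝ≥0∞) : ℝ≥0∞ :=
  ⨆ (z : Euc n) (r : Set.Ioi (0 : ℝ)),
    (volume (ball z (r : ℝ)) ^ (-κ) * ∫⁻ y in ball z (r : ℝ), F y ^ p) ^ (1 / p)

/-- Morrey norm `‖f‖_{L^{p,κ}}`. -/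
noncomputable def morreyNorm {n : ℕ} (p κ : ℝ) (f : Euc n → ℝ) : ℝ≥0∞ :=
  morreyNormE p κ (fun x => ENNReal.ofReal |f x|)

/-- Weak Morrey norm of a `[0,∞]`-valued function:
`sup_B sup_{l>0} m(B)^{-κ/p} · l · m({y ∈ B : F y > l})^{1/p}`. -/
noncomputable def weakMorreyNormE {n : ℕ} (p κ : ℝ) (F : Euc n → ℝ≥0∞) : ℝ≥0∞ :=
  ⨆ (z : Euc n) (r : Set.Ioi (0 : ℝ)) (l : Set.Ioi (0 : ℝ)),
    volume (ball z (r : ℝ)) ^ (-(κ / p)) * ENNReal.ofReal (l : ℝ) *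
      (volume {y | y ∈ ball z (r : ℝ) ∧ ENNReal.ofReal (l : ℝ) < F y}) ^ (1 / p)

/-- Weak Morrey norm `‖f‖_{WL^{p,κ}}`. -/
noncomputable def weakMorreyNorm {n : ℕ} (p κ : ℝ) (f : Euc n → ℝ) : ℝ≥0∞ :=
  weakMorreyNormE p κ (fun x => ENNReal.ofReal |f x|)

/-- Luxemburg norm `‖f‖_{L^p log L(B)}`. -/
noncomputable def luxNorm {n : ℕ} (p : ℝ) (B : Set (Euc n)) (f : Euc n → ℝ) : ℝ :=
  sInf {l : ℝ | 0 < l ∧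
    ∫⁻ x in B, ENNReal.ofReal ((|f x| / l) ^ p * (1 + max (Real.log (|f x| / l)) 0)) ≤ 1}

/-- `‖f‖_{(L log L)^{p,κ}} = sup_B m(B)^{-κ/p} ‖f‖_{L^p log L(B)}`. -/
noncomputable def logMorreyNorm {n : ℕ} (p κ : ℝ) (f : Euc n → ℝ) : ℝ≥0∞ :=
  ⨆ (z : Euc n) (r : Set.Ioi (0 : ℝ)),
    volume (ball z (r : ℝ)) ^ (-(κ / p)) *
      ENNReal.ofReal (luxNorm p (ball z (r : ℝ)) f)

/-- Weak `L^p` norm `‖f‖_{L^{p,∞}} = sup_{l>0} l · m({|f| > l})^{1/p}`. -/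
noncomputable def weakLpNorm {n : ℕ} (p : ℝ) (f : Euc n → ℝ) : ℝ≥0∞ :=
  ⨆ l : Set.Ioi (0 : ℝ),
    ENNReal.ofReal (l : ℝ) * (volume {x | (l : ℝ) < |f x|}) ^ (1 / p)

theorem prod_rpow_eq_rpow_sum {ι : Type*} (s : Finset ι) (x : ℝ≥0∞) {w : ι → ℝ}
    (hw0 : ∀ i, 0 ≤ w i) : ∏ i ∈ s, x ^ w i = x ^ ∑ i ∈ s, w i := by
  classical
  induction s using Finset.induction with
  | empty => simp
  | insert i s hi ih =>
    rw [Finset.prod_insert hi, Finset.sum_insert hi, ih,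
      ENNReal.rpow_add_of_nonneg _ _ (hw0 i) (Finset.sum_nonneg fun j _ => hw0 j)]

/-- Hölder's inequality for sums over an arbitrary index type, with weights of total mass one. -/
theorem tsum_prod_rpow_le {ι α : Type*} [Fintype ι] (A : ι → α → ℝ≥0∞) (w : ι → ℝ)
    (hw : ∑ i, w i = 1) (hw0 : ∀ i, 0 ≤ w i) :
    ∑' a, ∏ i, A i a ^ w i ≤ ∏ i, (∑' a, A i a) ^ w i := by
  let _ : MeasurableSpace α := ⊤
  simpa [lintegral_count] using
    ENNReal.lintegral_prod_norm_pow_le (μ := Measure.count) Finset.univ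
      (f := fun i a => A i a) (fun i _ => (measurable_from_top (f := A i)).aemeasurable) hw
      (fun i _ => hw0 i)

theorem volume_ball_mul {n : ℕ} (x z : Euc n) {c : ℝ} (hc : 0 < c) (r : ℝ) :
    volume (ball x (c * r)) = ENNReal.ofReal (c ^ n) * volume (ball z r) := by
  rw [Measure.addHaar_ball_mul_of_pos volume x hc r, ← Measure.addHaar_ball_center volume z r]
  simp

theorem volume_ball_ne_zero {n : ℕ} (x : Euc n) {r : ℝ} (hr : 0 < r) : volume (ball x r) ≠ 0 :=
  (measure_ball_pos volume x hr).ne'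

theorem volume_ball_ne_top {n : ℕ} (x : Euc n) (r : ℝ) : volume (ball x r) ≠ ⊤ :=
  measure_ball_lt_top.ne

theorem lintegral_ball_rpow_le_morreyNorm {n : ℕ} {p κ : ℝ} (hp : 0 < p) (f : Euc n → ℝ)
    (z : Euc n) {r : ℝ} (hr : 0 < r) :
    ∫⁻ y in ball z r, ENNReal.ofReal |f y| ^ p ≤
      volume (ball z r) ^ κ * morreyNorm p κ f ^ p := by
  have h : (volume (ball z r) ^ (-κ) * ∫⁻ y in ball z r, ENNReal.ofReal |f y| ^ p) ^ (1 / p) ≤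
      morreyNorm p κ f :=
    le_iSup₂_of_le (f := fun (z : Euc n) (r : Set.Ioi (0 : ℝ)) =>
      (volume (ball z (r : ℝ)) ^ (-κ) *
        ∫⁻ y in ball z (r : ℝ), ENNReal.ofReal |f y| ^ p) ^ (1 / p)) z ⟨r, hr⟩ le_rfl
  rw [one_div, ENNReal.rpow_inv_le_iff hp, ENNReal.rpow_neg, mul_comm, ← div_eq_mul_inv,
    ENNReal.div_le_iff_le_mul] at h
  · rwa [mul_comm]
  · exact Or.inl (ENNReal.rpow_pos (volume_ball_ne_zero z hr).pos (volume_ball_ne_top z r)).ne'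
  · exact Or.inl (ENNReal.rpow_ne_top_of_ne_zero (volume_ball_ne_zero z hr)
      (volume_ball_ne_top z r))

/-- Jensen's inequality for averages over balls. -/
theorem average_ball_le_rpow {n : ℕ} {p : ℝ} (hp : 1 ≤ p) {f : Euc n → ℝ} (hf : Measurable f)
    (z : Euc n) {r : ℝ} (hr : 0 < r) :
    (volume (ball z r))⁻¹ * ∫⁻ y in ball z r, ENNReal.ofReal |f y| ≤
      ((volume (ball z r))⁻¹ * ∫⁻ y in ball z r, ENNReal.ofReal |f y| ^ p) ^ (1 / p) := by
  have : IsProbabilityMeasure ((volume (ball z r))⁻¹ • (volume : Measure (Euc n)).restrict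
      (ball z r)) :=
    ⟨by simpa using ENNReal.inv_mul_cancel (volume_ball_ne_zero z hr) (volume_ball_ne_top z r)⟩
  have h := eLpNorm'_le_eLpNorm'_of_exponent_le (f := f) one_pos hp
    ((volume (ball z r))⁻¹ • (volume : Measure (Euc n)).restrict (ball z r))
    hf.aestronglyMeasurable
  simpa [eLpNorm'_eq_lintegral_enorm, lintegral_smul_measure, Real.enorm_eq_ofReal_abs] using h

/-- A ball on which the product of averages exceeds `l` is controlled by the `p i`-th power
integrals of the functions over this ball. -/
theorem volume_ball_mul_rpow_le {n m : ℕ} {p : Fin m → ℝ} (hp : ∀ i, 1 ≤ p i) {P : ℝ}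
    (hP0 : 0 < P) (hw : ∑ i, P / p i = 1) {f : Fin m → Euc n → ℝ} (hf : ∀ i, Measurable (f i))
    (z : Euc n) {r : ℝ} (hr : 0 < r) {l : ℝ≥0∞}
    (hl : l ≤ ∏ i, (volume (ball z r))⁻¹ * ∫⁻ y in ball z r, ENNReal.ofReal |f i y|) :
    volume (ball z r) * l ^ P ≤
      ∏ i, (∫⁻ y in ball z r, ENNReal.ofReal |f i y| ^ p i) ^ (P / p i) := by
  have hw0 (i) : 0 ≤ P / p i := div_nonneg hP0.le (zero_le_one.trans (hp i))
  set V := volume (ball z r)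
  have hV0 : V ≠ 0 := volume_ball_ne_zero z hr
  have hVt : V ≠ ⊤ := volume_ball_ne_top z r
  have hprod : ∏ i, (V⁻¹) ^ (P / p i) = V⁻¹ := by
    rw [prod_rpow_eq_rpow_sum _ _ hw0, hw, ENNReal.rpow_one]
  calc V * l ^ P
      ≤ V * (∏ i, (V⁻¹ * ∫⁻ y in ball z r, ENNReal.ofReal |f i y| ^ p i) ^ (1 / p i)) ^ P := by
        gcongr
        exact hl.trans (Finset.prod_le_prod' fun i _ => average_ball_le_rpow (hp i) (hf i) z hr)
    _ = V * (V⁻¹ * ∏ i, (∫⁻ y in ball z r, ENNReal.ofReal |f i y| ^ p i) ^ (P / p i)) := by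
        rw [← ENNReal.prod_rpow_of_nonneg hP0.le]
        conv_rhs => rw [← hprod, ← Finset.prod_mul_distrib]
        congr 1
        refine Finset.prod_congr rfl fun i _ => ?_
        rw [← ENNReal.rpow_mul, ← ENNReal.mul_rpow_of_nonneg _ _ (hw0 i), one_div_mul_eq_div]
    _ = _ := by rw [← mul_assoc, ENNReal.mul_inv_cancel hV0 hVt, one_mul]

theorem prod_lintegral_ball_rpow_le {n m : ℕ} {p : Fin m → ℝ} (hp : ∀ i, 1 ≤ p i) {P κ : ℝ}
    (hP0 : 0 < P) (hw : ∑ i, P / p i = 1) (f : Fin m → Euc n → ℝ)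
    (z : Euc n) {r : ℝ} (hr : 0 < r) :
    ∏ i, (∫⁻ y in ball z r, ENNReal.ofReal |f i y| ^ p i) ^ (P / p i) ≤
      volume (ball z r) ^ κ * (∏ i, morreyNorm (p i) κ (f i)) ^ P := by
  have hp0 (i) : 0 < p i := zero_lt_one.trans_le (hp i)
  have hw0 (i) : 0 ≤ P / p i := div_nonneg hP0.le (hp0 i).le
  calc _ ≤ ∏ i, (volume (ball z r) ^ κ * morreyNorm (p i) κ (f i) ^ p i) ^ (P / p i) :=
        Finset.prod_le_prod' fun i _ => ENNReal.rpow_le_rpow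
          (lintegral_ball_rpow_le_morreyNorm (hp0 i) (f i) z hr) (hw0 i)
    _ = ∏ i, (volume (ball z r) ^ κ) ^ (P / p i) * morreyNorm (p i) κ (f i) ^ P := by
        refine Finset.prod_congr rfl fun i _ => ?_
        rw [ENNReal.mul_rpow_of_nonneg _ _ (hw0 i), ← ENNReal.rpow_mul _ (p i),
          mul_div_cancel₀ _ (hp0 i).ne']
    _ = _ := by
        rw [Finset.prod_mul_distrib, prod_rpow_eq_rpow_sum _ _ hw0, hw,
          ENNReal.rpow_one, ENNReal.prod_rpow_of_nonneg hP0.le]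

/-- Vitali covering estimate: if every point of `E` is the center of a ball of radius at most `R`
whose volume is controlled by a product of masses, then so is `E`. -/
theorem volume_mul_le_of_ball_le {n m : ℕ} {w : Fin m → ℝ} (hw : ∑ i, w i = 1)
    (hw0 : ∀ i, 0 ≤ w i) (F : Fin m → Euc n → ℝ≥0∞) (z : Euc n) {R : ℝ} {E : Set (Euc n)}
    (hE : E ⊆ ball z R) (ρ : Euc n → ℝ) (hρ0 : ∀ x ∈ E, 0 < ρ x) (hρR : ∀ x ∈ E, ρ x ≤ R)
    {c : ℝ≥0∞}
    (hc : ∀ x ∈ E, volume (ball x (ρ x)) * c ≤ ∏ i, (∫⁻ y in ball x (ρ x), F i y) ^ w i) :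
    volume E * c ≤
      ENNReal.ofReal (4 ^ n) * ∏ i, (∫⁻ y in ball z (2 * R), F i y) ^ w i := by
  obtain ⟨u, huE, hdisj, hcov⟩ := Vitali.exists_disjoint_subfamily_covering_enlargement_closedBall
    E id ρ R hρR 4 (by norm_num)
  replace hdisj : u.PairwiseDisjoint fun x => ball x (ρ x) :=
    hdisj.mono fun x => ball_subset_closedBall
  have hu : u.Countable := hdisj.countable_of_isOpen (fun _ _ => isOpen_ball)
    fun x hx => ⟨x, mem_ball_self (hρ0 x (huE hx))⟩
  have : Countable u := hu.to_subtype
  have hvol (x : u) : volume (closedBall (x : Euc n) (4 * ρ x)) =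
      ENNReal.ofReal (4 ^ n) * volume (ball (x : Euc n) (ρ x)) := by
    have h4 : 0 < 4 * ρ x := by linarith [hρ0 x (huE x.2)]
    rw [Measure.addHaar_closedBall _ _ h4.le, ← Measure.addHaar_ball_of_pos _ (x : Euc n) h4,
      volume_ball_mul _ (x : Euc n) four_pos]
  have hsub : E ⊆ ⋃ x : u, closedBall (x : Euc n) (4 * ρ x) := fun x hx => by
    obtain ⟨b, hb, hxb⟩ := hcov x hx
    exact Set.mem_iUnion.2 ⟨⟨b, hb⟩, hxb (mem_closedBall_self (hρ0 x hx).le)⟩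
  have hsum (i : Fin m) :
      ∑' x : u, ∫⁻ y in ball (x : Euc n) (ρ x), F i y ≤ ∫⁻ y in ball z (2 * R), F i y := by
    rw [← lintegral_iUnion (fun x : u => measurableSet_ball)
      (fun x y hxy => hdisj x.2 y.2 (Subtype.coe_injective.ne hxy))]
    refine lintegral_mono_set (Set.iUnion_subset fun x => ball_subset_ball' ?_)
    have h1 := hρR x (huE x.2)
    have h2 := mem_ball.1 (hE (huE x.2))
    linarith
  calc volume E * c
      ≤ (∑' x : u, volume (closedBall (x : Euc n) (4 * ρ x))) * c := by
        gcongr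
        exact (measure_mono hsub).trans (measure_iUnion_le _)
    _ = ENNReal.ofReal (4 ^ n) * ∑' x : u, volume (ball (x : Euc n) (ρ x)) * c := by
        simp_rw [hvol, ENNReal.tsum_mul_left, ENNReal.tsum_mul_right, mul_assoc]
    _ ≤ ENNReal.ofReal (4 ^ n) *
          ∑' x : u, ∏ i, (∫⁻ y in ball (x : Euc n) (ρ x), F i y) ^ w i := by
        gcongr with x
        exact hc x (huE x.2)
    _ ≤ ENNReal.ofReal (4 ^ n) *
          ∏ i, (∑' x : u, ∫⁻ y in ball (x : Euc n) (ρ x), F i y) ^ w i := by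
        gcongr
        exact tsum_prod_rpow_le (fun i (x : u) => ∫⁻ y in ball (x : Euc n) (ρ x), F i y) w hw hw0
    _ ≤ _ := by
        gcongr with i
        exacts [hw0 i, hsum i]

/-- Distributional estimate for the multilinear maximal operator on a ball. -/
theorem volume_multiM_gt_mul_le {n m : ℕ} {p : Fin m → ℝ} (hp : ∀ i, 1 ≤ p i) {P κ : ℝ}
    (hP0 : 0 < P) (hw : ∑ i, P / p i = 1) (hκ0 : 0 ≤ κ) (hκ1 : κ ≤ 1) {f : Fin m → Euc n → ℝ}
    (hf : ∀ i, Measurable (f i)) (z : Euc n) {R : ℝ} (hR : 0 < R) (l : ℝ≥0∞) :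
    volume {y | y ∈ ball z R ∧ l < multiM m f y} * l ^ P ≤
      ENNReal.ofReal (8 ^ n) *
        (volume (ball z R) ^ κ * (∏ i, morreyNorm (p i) κ (f i)) ^ P) := by
  set E := {y | y ∈ ball z R ∧ l < multiM m f y}
  set Q := ∏ i, morreyNorm (p i) κ (f i)
  have hw0 (i) : 0 ≤ P / p i := div_nonneg hP0.le (zero_le_one.trans (hp i))
  have hEsub : E ⊆ ball z R := fun x hx => hx.1
  have hex (x) (hx : x ∈ E) : ∃ r : ℝ, 0 < r ∧ volume (ball x r) * l ^ P ≤
      ∏ i, (∫⁻ y in ball x r, ENNReal.ofReal |f i y| ^ p i) ^ (P / p i) := by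
    obtain ⟨⟨r, hr⟩, hlr⟩ := lt_iSup_iff.1 hx.2
    exact ⟨r, hr, volume_ball_mul_rpow_le hp hP0 hw hf x hr hlr.le⟩
  choose! ρ hρ0 hρ using hex
  by_cases hρR : ∀ x ∈ E, ρ x ≤ R
  · calc volume E * l ^ P
        ≤ ENNReal.ofReal (4 ^ n) *
          ∏ i, (∫⁻ y in ball z (2 * R), ENNReal.ofReal |f i y| ^ p i) ^ (P / p i) :=
          volume_mul_le_of_ball_le hw hw0 (fun i y => ENNReal.ofReal |f i y| ^ p i) z hEsub ρ
            hρ0 hρR hρ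
      _ ≤ ENNReal.ofReal (4 ^ n) * (volume (ball z (2 * R)) ^ κ * Q ^ P) := by
          gcongr
          exact prod_lintegral_ball_rpow_le hp hP0 hw f z (by positivity)
      _ ≤ ENNReal.ofReal (4 ^ n) *
          ((ENNReal.ofReal (2 ^ n) * volume (ball z R) ^ κ) * Q ^ P) := by
          rw [volume_ball_mul z z two_pos, ENNReal.mul_rpow_of_nonneg _ _ hκ0]
          gcongr
          exact (ENNReal.rpow_le_rpow_of_exponent_le
            (ENNReal.one_le_ofReal.2 (one_le_pow₀ one_le_two)) hκ1).trans_eq (ENNReal.rpow_one _)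
      _ = _ := by
          rw [show (8 : ℝ) = 4 * 2 by norm_num, mul_pow, ENNReal.ofReal_mul (by positivity)]
          ring
  · push Not at hρR
    obtain ⟨x, hx, hxR⟩ := hρR
    have h := (hρ x hx).trans
      (prod_lintegral_ball_rpow_le (κ := κ) hp hP0 hw f x (hρ0 x hx))
    set W := volume (ball x (ρ x)) with hW
    set V := volume (ball z R) with hV
    have hW0 : W ≠ 0 := volume_ball_ne_zero x (hρ0 x hx)
    have hWt : W ≠ ⊤ := volume_ball_ne_top x _
    have hV0 : V ≠ 0 := volume_ball_ne_zero z hR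
    have hVt : V ≠ ⊤ := volume_ball_ne_top z _
    have hVW : V ≤ W := by
      rw [hV, hW, Measure.addHaar_ball_center, Measure.addHaar_ball_center volume x]
      exact measure_mono (ball_subset_ball hxR.le)
    have hl : l ^ P ≤ W ^ (κ - 1) * Q ^ P := by
      rwa [ENNReal.rpow_sub _ _ hW0 hWt, ENNReal.rpow_one, div_eq_mul_inv, mul_right_comm,
        ← div_eq_mul_inv, ENNReal.le_div_iff_mul_le (Or.inl hW0) (Or.inl hWt), mul_comm]
    calc volume E * l ^ P ≤ V * (V ^ (κ - 1) * Q ^ P) := by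
          refine mul_le_mul' (measure_mono hEsub) (hl.trans ?_)
          gcongr ?_ * _
          rw [← neg_sub, ENNReal.rpow_neg, ENNReal.rpow_neg]
          exact ENNReal.inv_le_inv.2 (ENNReal.rpow_le_rpow hVW (by linarith))
      _ = V ^ κ * Q ^ P := by
          rw [ENNReal.rpow_sub _ _ hV0 hVt, ENNReal.rpow_one, ← mul_assoc,
            ENNReal.mul_div_cancel hV0 hVt]
      _ ≤ _ := le_mul_of_one_le_left' (ENNReal.one_le_ofReal.2 (one_le_pow₀ (by norm_num)))

/-- Weak type boundedness of the multilinear maximal operator on Morrey spaces when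
`min p_i = 1`. -/
theorem stmt8
    (n m : ℕ) (hn : 1 ≤ n) (hm : 1 ≤ m) (κ : ℝ) (hκ0 : 0 < κ) (hκ1 : κ < 1)
    (p : Fin m → ℝ) (hp : ∀ i, 1 ≤ p i) (hmin : ∃ i, p i = 1)
    (P : ℝ) (hP : 1 / P = ∑ i, 1 / p i) :
    ∃ C : ℝ, 0 < C ∧ ∀ f : Fin m → Euc n → ℝ,
      (∀ i, Measurable (f i)) → (∀ i, morreyNorm (p i) κ (f i) < ⊤) →
      weakMorreyNormE P κ (multiM m f) ≤
        ENNReal.ofReal C * ∏ i, morreyNorm (p i) κ (f i) := by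
  have hp0 (i) : 0 < p i := zero_lt_one.trans_le (hp i)
  have hP0 : 0 < P := by
    obtain ⟨i, -⟩ := hmin
    rw [← one_div_pos, hP]
    exact Finset.sum_pos (fun i _ => one_div_pos.2 (hp0 i)) ⟨i, Finset.mem_univ i⟩
  have hw : ∑ i, P / p i = 1 := by
    simp_rw [← mul_one_div P]
    rw [← Finset.mul_sum, ← hP, mul_one_div_cancel hP0.ne']
  refine ⟨(8 ^ n) ^ (1 / P), by positivity, fun f hf _ => ?_⟩
  refine iSup_le fun z => iSup_le fun R => iSup_le fun l => ?_
  have h := volume_multiM_gt_mul_le hp hP0 hw hκ0.le hκ1.le hf z R.2 (ENNReal.ofReal l)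
  have hV0 := volume_ball_ne_zero z R.2
  have hVt := volume_ball_ne_top z (R : ℝ)
  set V := volume (ball z (R : ℝ))
  set Q := ∏ i, morreyNorm (p i) κ (f i)
  set E := {y | y ∈ ball z (R : ℝ) ∧ ENNReal.ofReal (l : ℝ) < multiM m f y}
  have hinv : 0 ≤ 1 / P := one_div_nonneg.2 hP0.le
  have hroot (x : ℝ≥0∞) : (x ^ P) ^ (1 / P) = x := by
    rw [← ENNReal.rpow_mul, mul_one_div_cancel hP0.ne', ENNReal.rpow_one]
  calc V ^ (-(κ / P)) * ENNReal.ofReal l * volume E ^ (1 / P)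
      = (V ^ (-κ) * (volume E * ENNReal.ofReal l ^ P)) ^ (1 / P) := by
        rw [ENNReal.mul_rpow_of_nonneg _ _ hinv, ENNReal.mul_rpow_of_nonneg _ _ hinv, hroot,
          ← ENNReal.rpow_mul, neg_mul, mul_one_div, mul_assoc, mul_comm (volume E ^ _)]
    _ ≤ (V ^ (-κ) * (ENNReal.ofReal (8 ^ n) * (V ^ κ * Q ^ P))) ^ (1 / P) := by gcongr
    _ = (ENNReal.ofReal (8 ^ n) * Q ^ P) ^ (1 / P) := by
        rw [mul_left_comm, ← mul_assoc (V ^ (-κ)), ← ENNReal.rpow_add _ _ hV0 hVt,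
          neg_add_cancel, ENNReal.rpow_zero, one_mul]
    _ = ENNReal.ofReal ((8 ^ n) ^ (1 / P)) * Q := by
        rw [ENNReal.mul_rpow_of_nonneg _ _ hinv, hroot,
          ENNReal.ofReal_rpow_of_nonneg (by positivity) hinv]

end
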